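/- Let n ≥ 2 and let α₁, …, αₙ be real numbers with α₁ ≤ α₂ ≤ ⋯ ≤ αₙ, and set A = maxᵢ |αᵢ|. Define φ : ℝⁿ → ℝⁿ by φ(x)ᵢ = xᵢ |x|^{αᵢ} for x ≠ 0 and φ(0) = 0. Then for every x with 0 < |x| ≤ 1 the operator norm of the total derivative satisfies ‖Dφ(x)‖ ≤ (1 + A) |x|^{α₁}. -/

import Mathlib

/-- The generalized radial stretch mapping `φ(x)ᵢ = xᵢ |x|^{αᵢ}` (with `φ(0) = 0`). -/
noncomputable def radialStretch (n : ℕ) (α : Fin n → ℝ) :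
    EuclideanSpace ℝ (Fin n) → EuclideanSpace ℝ (Fin n) := fun x =>
  (WithLp.equiv 2 (Fin n → ℝ)).symm fun i => x i * ‖x‖ ^ α i

theorem EuclideanSpace.norm_toLp_mul_le {ι : Type*} [Fintype ι] {c : ι → ℝ} {C : ℝ}
    (hC : 0 ≤ C) (hc : ∀ i, |c i| ≤ C) (v : EuclideanSpace ℝ ι) :
    ‖(WithLp.toLp 2 fun i => c i * v i : EuclideanSpace ℝ ι)‖ ≤ C * ‖v‖ := by
  refine le_of_sq_le_sq ?_ (by positivity)
  rw [mul_pow, EuclideanSpace.norm_sq_eq, EuclideanSpace.norm_sq_eq, Finset.mul_sum]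
  refine Finset.sum_le_sum fun i _ => ?_
  simp only [Real.norm_eq_abs, abs_mul, mul_pow]
  gcongr
  exact hc i

theorem hasFDerivAt_norm_rpow_of_ne_zero {E : Type*} [NormedAddCommGroup E]
    [InnerProductSpace ℝ E] {x : E} (hx : x ≠ 0) (a : ℝ) :
    HasFDerivAt (fun y : E => ‖y‖ ^ a) ((a * ‖x‖ ^ (a - 2)) • innerSL ℝ x) x := by
  apply HasStrictFDerivAt.hasFDerivAt
  convert! (hasStrictFDerivAt_norm_sq x).rpow_const (p := a / 2) (by simp [hx]) using 0
  simp_rw [← Real.rpow_natCast_mul (norm_nonneg _), ← Nat.cast_smul_eq_nsmul ℝ, smul_smul]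
  ring_nf

/-- The derivative of the radial stretch away from the origin, factored through the diagonal map
with entries `‖x‖ ^ α i`. -/
theorem fderiv_radialStretch_apply {n : ℕ} (α : Fin n → ℝ) {x : EuclideanSpace ℝ (Fin n)}
    (hx : x ≠ 0) (v : EuclideanSpace ℝ (Fin n)) :
    fderiv ℝ (radialStretch n α) x v = WithLp.toLp 2 fun i =>
      ‖x‖ ^ α i * (v + (inner ℝ x v / ‖x‖ ^ 2) •
        (WithLp.toLp 2 fun j => α j * x j : EuclideanSpace ℝ (Fin n))) i := by
  have hr : 0 < ‖x‖ := norm_pos_iff.2 hx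
  have hcoord : ∀ i, HasFDerivAt (fun y => radialStretch n α y i)
      (x i • ((α i * ‖x‖ ^ (α i - 2)) • innerSL ℝ x) +
        ‖x‖ ^ α i • EuclideanSpace.proj (𝕜 := ℝ) i) x := fun i =>
    ((EuclideanSpace.proj (𝕜 := ℝ) i).hasFDerivAt (x := x)).mul
      (hasFDerivAt_norm_rpow_of_ne_zero hx (α i))
  have hdiff : DifferentiableAt ℝ (radialStretch n α) x :=
    differentiableAt_euclidean.2 fun i => (hcoord i).differentiableAt
  ext i
  have h := ((EuclideanSpace.proj (𝕜 := ℝ) i).hasFDerivAt.comp x hdiff.hasFDerivAt).unique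
    (hcoord i)
  have hv := congrArg (fun L => L v) h
  have hpow : ‖x‖ ^ (α i - 2) = ‖x‖ ^ α i / ‖x‖ ^ 2 := by
    rw [Real.rpow_sub hr]
    norm_num
  simp only [ContinuousLinearMap.comp_apply, PiLp.proj_apply,
    add_apply, smul_apply, smul_eq_mul,
    innerSL_apply_apply, hpow] at hv
  rw [hv]
  simp only [PiLp.add_apply, PiLp.smul_apply, smul_eq_mul]
  ring

/-- Let `n ≥ 2`, `α₁ ≤ α₂ ≤ ⋯ ≤ αₙ` and `A = maxᵢ |αᵢ|`. For every `x` with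
`0 < |x| ≤ 1`, the operator norm of the total derivative of the generalized radial
stretch satisfies `‖Dφ(x)‖ ≤ (1 + A)|x|^{α₁}`. -/
theorem radialStretch_fderiv_norm_bound (n : ℕ) (hn : 2 ≤ n) (α : Fin n → ℝ)
    (hmono : Monotone α) (A : ℝ) (hA : ∀ i, |α i| ≤ A) (hA' : ∃ i, |α i| = A)
    (x : EuclideanSpace ℝ (Fin n)) (hx0 : 0 < ‖x‖) (hx1 : ‖x‖ ≤ 1) :
    ‖fderiv ℝ (radialStretch n α) x‖ ≤ (1 + A) * ‖x‖ ^ α ⟨0, by omega⟩ := by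
  have hA0 : 0 ≤ A := (abs_nonneg _).trans (hA ⟨0, by omega⟩)
  have hx : x ≠ 0 := norm_pos_iff.1 hx0
  refine ContinuousLinearMap.opNorm_le_bound _ (by positivity) fun v => ?_
  have hradial : ‖(inner ℝ x v / ‖x‖ ^ 2) •
      (WithLp.toLp 2 fun j => α j * x j : EuclideanSpace ℝ (Fin n))‖ ≤ A * ‖v‖ := by
    rw [norm_smul, norm_div, norm_pow, norm_norm]
    calc _ ≤ ‖x‖ * ‖v‖ / ‖x‖ ^ 2 * (A * ‖x‖) := by
          gcongr
          · exact norm_inner_le_norm x v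
          · exact EuclideanSpace.norm_toLp_mul_le hA0 hA x
      _ = A * ‖v‖ := by field_simp
  rw [fderiv_radialStretch_apply α hx]
  calc _ ≤ ‖x‖ ^ α ⟨0, by omega⟩ * _ :=
        EuclideanSpace.norm_toLp_mul_le (by positivity) (fun i => by
          rw [abs_of_nonneg (by positivity)]
          exact Real.rpow_le_rpow_of_exponent_ge hx0 hx1 (hmono (Nat.zero_le _))) _
    _ ≤ ‖x‖ ^ α ⟨0, by omega⟩ * (‖v‖ + A * ‖v‖) := by
        gcongr
        exact (norm_add_le _ _).trans (by gcongr)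
    _ = (1 + A) * ‖x‖ ^ α ⟨0, by omega⟩ * ‖v‖ := by ring
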